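/- Let p ≡ 3 (mod 4), let e = 2m with m ≥ 1, and suppose s divides m and m/s ≡ 0 (mod 2). Then for i = 0, 1 and a, b ∈ F_q: (1) if a = 0 and b = 0, then T_i(a,b) = ((p-1)/2)(p^{2e-2} + p^{e+m+s-2}); (2) if a = 0 and b ∈ F_p^*, then T_i(a,b) = 0; (3) if a = 0 and b ∈ F_q^* \ F_p^*, then T_i(a,b) = ((p-1)/2)(p^{2e-3} + p^{e+m+s-3}); (4) if a ≠ 0 and b = 0: if the equation X^{p^{2l}} + X = -a^{p^l} has no solution in F_q then T_i(a,b) = ((p-1)/2)(p^{2e-3} + p^{e+m+s-3}); if it has a solution γ then T_i(a,b) = ((p-1)/2)(p^{2e-3} + p^{e+m+s-2}) if Tr(γ^{p^l+1}) = 0 or Tr(γ^{p^l+1}) ∈ C_0^{(2,p)}, while T_i(a,b) = ((p-1)/2)(p^{2e-3} - p^{e+m+s-2}) if Tr(γ^{p^l+1}) ∈ C_1^{(2,p)}; (5) if a ≠ 0 and b ∈ F_p^*: if the equation X^{p^{2l}} + X = -a^{p^l} has no solution in F_q then T_i(a,b) = ((p-1)/2)(p^{2e-3} + p^{e+m+s-3});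 if it has a solution γ then T_i(a,b) = ((p-1)/2) p^{2e-3} if Tr(γ^{p^l+1}) = 0 or Tr(γ^{p^l+1}) ∈ C_0^{(2,p)}, while T_i(a,b) = ((p-1)/2) p^{2e-3} + p^{e+m+s-2} if Tr(γ^{p^l+1}) ∈ C_1^{(2,p)}; (6) if a ≠ 0 and b ∈ F_q^* \ F_p^*, then T_i(a,b) = ((p-1)/2)(p^{2e-3} + p^{e+m+s-3}). -/

import Mathlib

open scoped BigOperators

noncomputable section

/-- The primitive `p`-th root of unity `ζ_p = exp(2πi/p)`. -/
def zetaP (p : ℕ) : ℂ := Complex.exp (2 * Real.pi * Complex.I / p)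

/-- The absolute trace map from `F_q = GF(p^e)` onto `F_p`. -/
def tr (p e : ℕ) [Fact p.Prime] (x : GaloisField p e) : ZMod p :=
  Algebra.trace (ZMod p) (GaloisField p e) x

/-- The Weil sum `S(α, β) = Σ_{x ∈ F_q} ζ_p^{Tr(α x^{p^l+1} + β x)}`. -/
def weilSum (p e l : ℕ) [Fact p.Prime] (α β : GaloisField p e) : ℂ :=
  letI : Fintype (GaloisField p e) := Fintype.ofFinite _
  ∑ x : GaloisField p e, zetaP p ^ (tr p e (α * x ^ (p ^ l + 1) + β * x)).val

/- The quadratic character `η` of `F_p`, integer-valued: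
`η(0) = 0`, `η(x) = 1` for nonzero squares, `η(x) = -1` for nonsquares. -/
open Classical in
def eta (p : ℕ) (x : ZMod p) : ℤ :=
  if x = 0 then 0 else if IsSquare x then 1 else -1

/- The cyclotomic classes of order 2 in `F_p^*`: `cyc p 0` is the set of nonzero
squares `C_0^{(2,p)}`, and `cyc p 1` is the set of nonsquares `C_1^{(2,p)}`. -/
open Classical in
def cyc (p : ℕ) [Fact p.Prime] (i : ℕ) : Finset (ZMod p) :=
  Finset.univ.filter (fun x => x ≠ 0 ∧ (if i = 0 then IsSquare x else ¬ IsSquare x))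

/-- `ψ_3(a) = ((p-1)/2) p^{e-3} Σ_{z1 ∈ F_p^*} ζ_p^{-z1} Σ_{z3 ∈ F_p^*} S(z1, a z3)`. -/
def psi3 (p e l : ℕ) [Fact p.Prime] (a : GaloisField p e) : ℂ :=
  ((p : ℂ) - 1) / 2 * (p : ℂ) ^ ((e : ℤ) - 3) *
    ∑ z1 ∈ ({0}ᶜ : Finset (ZMod p)), zetaP p ^ (-z1).val *
      ∑ z3 ∈ ({0}ᶜ : Finset (ZMod p)),
        weilSum p e l (algebraMap (ZMod p) (GaloisField p e) z1)
          (a * algebraMap (ZMod p) (GaloisField p e) z3)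

/-- `ψ_4^{(i)}(a, b) = p^{e-3} Σ_{c ∈ C_i} Σ_{z1 ∈ F_p^*} ζ_p^{-z1}
      Σ_{z2 ∈ F_p^*} ζ_p^{-c z2} S(z1, -a b⁻¹ z2)`, for `b ∈ F_p^*`. -/
def psi4 (p e l : ℕ) [Fact p.Prime] (i : ℕ) (a : GaloisField p e) (b : ZMod p) : ℂ :=
  (p : ℂ) ^ ((e : ℤ) - 3) *
    ∑ c ∈ cyc p i, ∑ z1 ∈ ({0}ᶜ : Finset (ZMod p)), zetaP p ^ (-z1).val *
      ∑ z2 ∈ ({0}ᶜ : Finset (ZMod p)), zetaP p ^ (-(c * z2)).val *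
        weilSum p e l (algebraMap (ZMod p) (GaloisField p e) z1)
          (-a * algebraMap (ZMod p) (GaloisField p e) (b⁻¹ * z2))

/-- `T_i(a,b) = |{(x1,x2) ∈ F_q² : Tr(x1^{p^l+1}) = 1, Tr(x2) ∈ C_i, Tr(a x1 + b x2) = 0}|`. -/
def Tcount (p e l : ℕ) [Fact p.Prime] (i : ℕ) (a b : GaloisField p e) : ℕ :=
  Nat.card {x : GaloisField p e × GaloisField p e //
    tr p e (x.1 ^ (p ^ l + 1)) = 1 ∧ tr p e x.2 ∈ cyc p i ∧ tr p e (a * x.1 + b * x.2) = 0}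

/-- The defining set `D_i = {(x1,x2) ∈ F_q² : Tr(x1^{p^l+1}) = 1, Tr(x2) ∈ C_i^{(2,p)}}`. -/
def Dset (p e l : ℕ) [Fact p.Prime] (i : ℕ) : Set (GaloisField p e × GaloisField p e) :=
  {x | tr p e (x.1 ^ (p ^ l + 1)) = 1 ∧ tr p e x.2 ∈ cyc p i}

/-- The codeword of `C_{D_i}` indexed by `(a, b) ∈ F_q²`:
the vector `(Tr(a x1 + b x2))_{(x1,x2) ∈ D_i}`. -/
def codeword (p e l : ℕ) [Fact p.Prime] (i : ℕ) (a b : GaloisField p e) :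
    Dset p e l i → ZMod p :=
  fun x => tr p e (a * x.1.1 + b * x.1.2)

/-- The linear code `C_{D_i} = {(Tr(a x1 + b x2))_{(x1,x2) ∈ D_i} : a, b ∈ F_q}`. -/
def code (p e l : ℕ) [Fact p.Prime] (i : ℕ) : Set (Dset p e l i → ZMod p) :=
  Set.range (fun ab : GaloisField p e × GaloisField p e => codeword p e l i ab.1 ab.2)

/-- The Hamming weight of a vector: the number of nonzero coordinates. -/
def wt {ι : Type*} {p : ℕ} (c : ι → ZMod p) : ℕ := Nat.card {x : ι // c x ≠ 0}

section Helpers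

open Classical

theorem cnt_iter {F : Type*} [Monoid F] (w : F) (N j : ℕ) (h : w ^ N = w) : w ^ (N ^ j) = w := by
  induction j with
  | zero => simp
  | succ j ih => rw [pow_succ, pow_mul, ih, h]

theorem cnt_root {F : Type*} [Field F] [Fintype F] (z : F) (hz : z ≠ 0) (d k : ℕ)
    (hdk : d * k = Fintype.card F - 1) (hzk : z ^ k = 1) : ∃ w : F, w ≠ 0 ∧ w ^ d = z := by
  obtain ⟨g, hg⟩ := IsCyclic.exists_generator (α := Fˣ)
  have hord : orderOf g = Fintype.card F - 1 := by
    rw [orderOf_eq_card_of_forall_mem_zpowers hg, Nat.card_eq_fintype_card, Fintype.card_units]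
  obtain ⟨i, hi⟩ := (mem_powers_iff_mem_zpowers.2 (hg (Units.mk0 z hz)))
  simp only at hi
  have h1 : g ^ (i * k) = 1 := by
    rw [pow_mul, hi]
    ext; simpa using hzk
  have h2 := orderOf_dvd_of_pow_eq_one h1
  rw [hord, ← hdk] at h2
  have hpos : 0 < Fintype.card F - 1 := by
    have := Fintype.one_lt_card (α := F); omega
  have hk : 0 < k := by
    rcases Nat.eq_zero_or_pos k with h | h
    · subst h; simp at hdk; omega
    · exact h
  obtain ⟨j, rfl⟩ := Nat.dvd_of_mul_dvd_mul_right hk h2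
  refine ⟨((g ^ j : Fˣ) : F), Units.ne_zero _, ?_⟩
  rw [← Units.val_pow_eq_pow_val, ← pow_mul, mul_comm, hi]; rfl

theorem cnt_unity {F : Type*} [Field F] [Fintype F] (d : ℕ) (hd : d ∣ Fintype.card F - 1) :
    (Finset.univ.filter (fun u : F => u ^ d = 1)).card = d := by
  obtain ⟨k, hk⟩ := hd
  have hpos : 0 < Fintype.card F - 1 := by
    have := Fintype.one_lt_card (α := F); omega
  obtain ⟨g, hg⟩ := IsCyclic.exists_ofOrder_eq_natCard (α := Fˣ)
  rw [Nat.card_eq_fintype_card, Fintype.card_units] at hg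
  have h1 : IsPrimitiveRoot (g : F) (Fintype.card F - 1) := by
    rw [← hg, IsPrimitiveRoot.coe_units_iff]; exact IsPrimitiveRoot.orderOf g
  have h2 : IsPrimitiveRoot ((g : F) ^ k) d := h1.pow hpos (by rw [hk, mul_comm])
  have hd0 : 0 < d := by
    rcases Nat.eq_zero_or_pos d with h | h
    · subst h; simp at hk; omega
    · exact h
  refine Eq.trans ?_ h2.card_nthRootsFinset
  congr 1
  ext u
  simp [Polynomial.mem_nthRootsFinset hd0]

/-- translation-invariance counting lemma -/
theorem cnt_trans {p : ℕ} [Fact p.Prime] {V : Type*} [AddCommGroup V] [Fintype V]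
    [Module (ZMod p) V] (P : V → Prop) (g : V →ₗ[ZMod p] ZMod p) (u : V) (hu : g u ≠ 0)
    (hP : ∀ x (k : ZMod p), P x → P (x + k • u)) (t : ZMod p) :
    p * (Finset.univ.filter (fun x => P x ∧ g x = t)).card =
      (Finset.univ.filter (fun x => P x)).card := by
  have key : ∀ t' : ZMod p, (Finset.univ.filter (fun x => P x ∧ g x = t')).card =
      (Finset.univ.filter (fun x => P x ∧ g x = t)).card := by
    intro t'
    refine Finset.card_bij' (fun x _ => x + ((t - t') / g u) • u)
      (fun x _ => x + (-((t - t') / g u)) • u) ?_ ?_ ?_ ?_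
    · intro x hx
      simp only [Finset.mem_filter, Finset.mem_univ, true_and] at hx ⊢
      refine ⟨hP _ _ hx.1, ?_⟩
      rw [map_add, map_smul, hx.2, smul_eq_mul, div_mul_cancel₀ _ hu]; ring
    · intro x hx
      simp only [Finset.mem_filter, Finset.mem_univ, true_and] at hx ⊢
      refine ⟨hP _ _ hx.1, ?_⟩
      rw [map_add, map_smul, hx.2, smul_eq_mul, neg_mul, div_mul_cancel₀ _ hu]; ring
    · intro x _; simp
    · intro x _; simp
  rw [Finset.card_eq_sum_card_fiberwise (s := Finset.univ.filter (fun x => P x)) (f := g)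
    (t := Finset.univ) (by intro x _; simp)]
  simp only [Finset.filter_filter]
  rw [Finset.sum_congr rfl (fun t' _ => key t')]
  simp [ZMod.card]

variable {p : ℕ} [Fact p.Prime] {F : Type*} [Field F] [Fintype F] [Algebra (ZMod p) F]

/-- abbreviation for the trace -/
noncomputable abbrev TR (p : ℕ) [Fact p.Prime] (F : Type*) [Field F] [Fintype F] [Algebra (ZMod p) F] :
    F →ₗ[ZMod p] ZMod p := Algebra.trace (ZMod p) F

theorem TR_frob (x : F) (k : ℕ) : TR p F (x ^ p ^ k) = TR p F x := by
  have : CharP F p := charP_of_injective_algebraMap (algebraMap (ZMod p) F).injective p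
  induction k with
  | zero => simp
  | succ k ih =>
    rw [pow_succ, pow_mul, ← ih]
    have := Algebra.trace_eq_of_algEquiv (FiniteField.frobeniusAlgEquiv (ZMod p) F p) (x ^ p ^ k)
    rw [← this]
    simp [FiniteField.frobeniusAlgEquiv_apply, ZMod.card]

theorem TR_nondeg (c : F) (h : ∀ x, TR p F (c * x) = 0) : c = 0 := by
  by_contra hc
  obtain ⟨x, hx⟩ := Algebra.trace_surjective (ZMod p) F 1
  have := h (c⁻¹ * x)
  rw [mul_inv_cancel_left₀ hc] at this
  rw [this] at hx
  exact zero_ne_one hx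

theorem TR_rep (φ : F →ₗ[ZMod p] ZMod p) : ∃ c : F, ∀ x, φ x = TR p F (c * x) := by
  let f : F →ₗ[ZMod p] Module.Dual (ZMod p) F := Algebra.traceForm (ZMod p) F
  have hinj : Function.Injective f := by
    rw [← LinearMap.ker_eq_bot, LinearMap.ker_eq_bot']
    intro c hc
    apply TR_nondeg (p := p)
    intro x
    exact LinearMap.congr_fun hc x
  have hs : Function.Surjective f :=
    (LinearMap.injective_iff_surjective_of_finrank_eq_finrank
      (Subspace.dual_finrank_eq).symm).1 hinj
  obtain ⟨c, hc⟩ := hs φ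
  exact ⟨c, fun x => by rw [← hc]; rfl⟩

/-- The quadratic form -/
noncomputable def QF (p : ℕ) [Fact p.Prime] (l : ℕ) {F : Type*} [Field F] [Fintype F] [Algebra (ZMod p) F]
    (x : F) : ZMod p := TR p F (x ^ (p ^ l + 1))

theorem QF_add (l : ℕ) (x h : F) :
    QF p l (x + h) = QF p l x + QF p l h + TR p F (x ^ p ^ l * (h ^ p ^ (2 * l) + h)) := by
  have : CharP F p := charP_of_injective_algebraMap (algebraMap (ZMod p) F).injective p
  unfold QF
  have h1 : TR p F (x ^ p ^ l * (h ^ p ^ (2 * l) + h)) =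
      TR p F (x * h ^ p ^ l) + TR p F (x ^ p ^ l * h) := by
    rw [mul_add, map_add, ← TR_frob (x * h ^ p ^ l) l, mul_pow, ← pow_mul, ← pow_add, two_mul]
  rw [h1, ← map_add, ← map_add, ← map_add]
  congr 1
  rw [pow_succ, add_pow_char_pow]; ring

theorem QF_smul (l : ℕ) (k : ZMod p) (x : F) : QF p l (k • x) = k ^ 2 * QF p l x := by
  unfold QF
  rw [smul_pow, map_smul, smul_eq_mul, pow_succ k, ZMod.pow_card_pow, sq]

theorem A_smul (l : ℕ) (k : ZMod p) (h : F) :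
    (k • h) ^ p ^ (2 * l) + k • h = k • (h ^ p ^ (2 * l) + h) := by
  rw [smul_pow, ZMod.pow_card_pow, smul_add]

theorem QF_rad (hp2 : p ≠ 2) (l : ℕ) (h : F) (hr : h ^ p ^ (2 * l) + h = 0) : QF p l h = 0 := by
  have h1 := QF_add (p := p) l h h
  rw [hr, mul_zero, map_zero, add_zero, ← two_smul (ZMod p) h, QF_smul] at h1
  have h2 : (2 : ZMod p) * QF p l h = 0 := by linear_combination h1
  have h3 : (2 : ZMod p) ≠ 0 := by
    intro h
    have : ((2 : ℕ) : ZMod p) = 0 := by exact_mod_cast h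
    rw [ZMod.natCast_eq_zero_iff] at this
    exact hp2 ((Nat.prime_dvd_prime_iff_eq Fact.out Nat.prime_two).1 this)
  exact (mul_eq_zero.1 h2).resolve_left h3

theorem nonsolv (l : ℕ) (a : F) (hno : ¬ ∃ x : F, x ^ p ^ (2 * l) + x = -a ^ p ^ l) :
    ∃ d : F, d ^ p ^ (2 * l) + d = 0 ∧ TR p F (a * d) ≠ 0 := by
  have : CharP F p := charP_of_injective_algebraMap (algebraMap (ZMod p) F).injective p
  let A : F →ₗ[ZMod p] F :=
    { toFun := fun x => x ^ p ^ (2 * l) + x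
      map_add' := fun x y => by rw [add_pow_char_pow]; ring
      map_smul' := fun k x => A_smul l k x }
  have h1 : -a ^ p ^ l ∉ LinearMap.range A := by
    rintro ⟨x, hx⟩; exact hno ⟨x, hx⟩
  obtain ⟨φ, hφ, hle⟩ := Submodule.exists_le_ker_of_notMem h1
  obtain ⟨c, hc⟩ := TR_rep φ
  have hfs : Function.Surjective (fun x : F => x ^ p ^ l) := by
    have := (iterateFrobeniusEquiv F p l).surjective
    intro y
    obtain ⟨x, hx⟩ := this y
    exact ⟨x, by simpa [iterateFrobenius_def] using hx⟩
  obtain ⟨d, rfl⟩ := hfs c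
  refine ⟨d, ?_, ?_⟩
  · apply TR_nondeg (p := p)
    intro y
    obtain ⟨x, rfl⟩ := hfs y
    have h2 : φ (A x) = 0 := hle ⟨x, rfl⟩
    rw [hc] at h2
    rw [← h2]
    show TR p F ((d ^ p ^ (2 * l) + d) * x ^ p ^ l) = TR p F (d ^ p ^ l * (x ^ p ^ (2 * l) + x))
    rw [add_mul, mul_add, map_add, map_add, add_comm]
    congr 1
    · rw [← TR_frob (d * x ^ p ^ l) l, mul_pow, ← pow_mul, ← pow_add, two_mul]
    · rw [← TR_frob (d ^ p ^ l * x) l, mul_pow, ← pow_mul, ← pow_add, two_mul]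
  · intro h
    apply hφ
    rw [hc, mul_neg, ← mul_pow, map_neg, TR_frob, mul_comm, h, neg_zero]

theorem scale_ex (e l s k j : ℕ) (hF : Fintype.card F = p ^ e) 
    (hl : l = s * (2 * j + 1)) (he : e = 2 * s * k) (z : ZMod p) (hz : z ≠ 0) :
    ∃ w : F, w ≠ 0 ∧ w ^ (p ^ l + 1) = algebraMap (ZMod p) F z := by
  have hp1 : 1 < p := (Fact.out : p.Prime).one_lt
  obtain ⟨K1, hK1⟩ : (p ^ (2 * s) - 1) ∣ (p ^ e - 1) := by
    have := Nat.sub_dvd_pow_sub_pow (p ^ (2 * s)) 1 k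
    rwa [one_pow, ← pow_mul, ← he] at this
  obtain ⟨K2, hK2⟩ : (p - 1) ∣ (p ^ s - 1) := by
    have := Nat.sub_dvd_pow_sub_pow p 1 s
    rwa [one_pow] at this
  have hps : p ^ (2 * s) - 1 = (p ^ s + 1) * (p ^ s - 1) := by
    rw [mul_comm 2 s, pow_mul]
    have := Nat.sq_sub_sq (p ^ s) 1
    simpa using this
  have hz0 : algebraMap (ZMod p) F z ≠ 0 := by simpa using hz
  obtain ⟨w, hw0, hw⟩ := cnt_root (algebraMap (ZMod p) F z) hz0 (p ^ s + 1) ((p - 1) * (K2 * K1))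
    (by rw [hF, hK1, hps, hK2]; ring) (by
      rw [pow_mul, ← map_pow, ZMod.pow_card_sub_one_eq_one hz, map_one, one_pow])
  refine ⟨w, hw0, ?_⟩
  have h1 : w ^ p ^ s * w = algebraMap (ZMod p) F z := by rw [← pow_succ, hw]
  have h2 : w ^ p ^ (2 * s) * w ^ p ^ s = algebraMap (ZMod p) F z := by
    have := congrArg (fun x => x ^ p ^ s) h1
    simp only [mul_pow] at this
    rw [← map_pow, ZMod.pow_card_pow, ← pow_mul w, ← pow_add p, ← two_mul] at this
    exact this
  have h3 : w ^ p ^ (2 * s) = w := by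
    have hne : w ^ p ^ s ≠ 0 := pow_ne_zero _ hw0
    apply mul_right_cancel₀ hne
    rw [h2, ← h1, mul_comm]
  have h4 : w ^ p ^ l = w ^ p ^ s := by
    have : p ^ l = (p ^ (2 * s)) ^ j * p ^ s := by
      rw [hl, ← pow_mul, ← pow_add]; congr 1; ring
    rw [this, pow_mul, cnt_iter _ _ _ h3]
  rw [pow_succ, h4, h1]

theorem QF_const (e l s k j : ℕ) (hF : Fintype.card F = p ^ e) 
    (hl : l = s * (2 * j + 1)) (he : e = 2 * s * k) (z : ZMod p) (hz : z ≠ 0) :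
    (Finset.univ.filter (fun x : F => QF p l x = z)).card =
      (Finset.univ.filter (fun x : F => QF p l x = 1)).card := by
  obtain ⟨w, hw0, hw⟩ := scale_ex e l s k j hF hl he z hz
  have hQ : ∀ x, QF p l (w * x) = z * QF p l x := by
    intro x
    unfold QF
    rw [mul_pow, hw, ← Algebra.smul_def, map_smul, smul_eq_mul]
  symm
  refine Finset.card_bij' (fun x _ => w * x) (fun x _ => w⁻¹ * x) ?_ ?_ ?_ ?_
  · intro x hx
    simp only [Finset.mem_filter, Finset.mem_univ, true_and] at hx ⊢
    rw [hQ, hx, mul_one]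
  · intro x hx
    simp only [Finset.mem_filter, Finset.mem_univ, true_and] at hx ⊢
    apply mul_left_cancel₀ hz
    rw [← hQ, mul_inv_cancel_left₀ hw0, hx, mul_one]
  · intro x _; simp [hw0]
  · intro x _; simp [hw0]

theorem QF_dvd (e l s k j : ℕ) (hF : Fintype.card F = p ^ e) 
    (hl : l = s * (2 * j + 1)) (he : e = 2 * s * k) :
    (p ^ s + 1) ∣ (Finset.univ.filter (fun x : F => QF p l x = 1)).card := by
  have hd : (p ^ s + 1) ∣ Fintype.card F - 1 := by
    rw [hF]
    have := Nat.sub_dvd_pow_sub_pow (p ^ (2 * s)) 1 k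
    rw [one_pow, ← pow_mul, ← he] at this
    refine dvd_trans ?_ this
    rw [mul_comm 2 s, pow_mul]
    have := Nat.sq_sub_sq (p ^ s) 1
    rw [one_pow] at this
    exact ⟨_, this⟩
  have hU : ∀ u : F, u ^ (p ^ s + 1) = 1 → u ^ (p ^ l + 1) = 1 := by
    intro u hu
    have hu0 : u ≠ 0 := by rintro rfl; simp at hu
    have h1 : u ^ p ^ s * u = 1 := by rw [← pow_succ, hu]
    have h2 : u ^ p ^ (2 * s) * u ^ p ^ s = 1 := by
      have := congrArg (fun x => x ^ p ^ s) h1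
      simp only [mul_pow] at this
      rw [← pow_mul u, ← pow_add p, ← two_mul, one_pow] at this
      exact this
    have h3 : u ^ p ^ (2 * s) = u := by
      have hne : u ^ p ^ s ≠ 0 := pow_ne_zero _ hu0
      apply mul_right_cancel₀ hne
      rw [h2, ← h1, mul_comm]
    have h4 : u ^ p ^ l = u ^ p ^ s := by
      have : p ^ l = (p ^ (2 * s)) ^ j * p ^ s := by
        rw [hl, ← pow_mul, ← pow_add]; congr 1; ring
      rw [this, pow_mul, cnt_iter _ _ _ h3]
    rw [pow_succ, h4, h1]
  have hQ : ∀ u x : F, u ^ (p ^ s + 1) = 1 → QF p l (u * x) = QF p l x := by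
    intro u x hu
    unfold QF
    rw [mul_pow, hU u hu, one_mul]
  rw [Finset.card_eq_sum_card_image (fun x : F => x ^ (p ^ s + 1))]
  apply Finset.dvd_sum
  intro b hb
  obtain ⟨x0, hx0, rfl⟩ := Finset.mem_image.1 hb
  simp only [Finset.mem_filter, Finset.mem_univ, true_and] at hx0
  have hx00 : x0 ≠ 0 := by
    rintro rfl
    simp [QF] at hx0
  apply dvd_of_eq
  refine Eq.trans (cnt_unity (p ^ s + 1) hd).symm ?_
  refine Finset.card_bij' (fun x _ => x * x0) (fun x _ => x * x0⁻¹) ?_ ?_ ?_ ?_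
  · intro x hx
    simp only [Finset.mem_filter, Finset.mem_univ, true_and] at hx ⊢
    rw [hQ _ _ hx, mul_pow, hx, one_mul]
    exact ⟨hx0, rfl⟩
  · intro x hx
    simp only [Finset.mem_filter, Finset.mem_univ, true_and] at hx ⊢
    rw [mul_pow, hx.2, ← mul_pow, mul_inv_cancel₀ hx00, one_pow]
  · intro x _; simp [hx00]
  · intro x _; simp [hx00]

theorem rad_card (hp2 : p ≠ 2) (e l s k j : ℕ) (hF : Fintype.card F = p ^ e)
    (hl : l = s * (2 * j + 1)) (he : e = 2 * s * k) (hk : Even k) (hg : Nat.gcd (2 * l) e = 2 * s) :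
    (Finset.univ.filter (fun x : F => x ^ p ^ (2 * l) + x = 0)).card = p ^ (2 * s) := by
  have hp1 : 1 < p := (Fact.out : p.Prime).one_lt
  have hodd : Odd p := (Fact.out : p.Prime).odd_of_ne_two hp2
  have hdvd : (p ^ (2 * s) - 1) ∣ (p ^ e - 1) := by
    have := Nat.sub_dvd_pow_sub_pow (p ^ (2 * s)) 1 k
    rwa [one_pow, ← pow_mul, ← he] at this
  obtain ⟨v, hv0, hv⟩ : ∃ v : F, v ≠ 0 ∧ v ^ (p ^ (2 * s) - 1) = -1 := by
    obtain ⟨k', rfl⟩ := hk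
    have h1 : (p ^ (2 * s) - 1) ∣ (p ^ (2 * s * k') - 1) := by
      have := Nat.sub_dvd_pow_sub_pow (p ^ (2 * s)) 1 k'
      rwa [one_pow, ← pow_mul] at this
    obtain ⟨K, hK⟩ := h1
    refine cnt_root (-1 : F) (by simp) (p ^ (2 * s) - 1) (K * (p ^ (2 * s * k') + 1)) ?_ ?_
    · rw [hF, ← mul_assoc, ← hK, he]
      have := Nat.sq_sub_sq (p ^ (2 * s * k')) 1
      rw [one_pow, ← pow_mul] at this
      rw [mul_comm, ← this]
      congr 2; ring
    · rw [mul_comm, pow_mul, Even.neg_one_pow, one_pow]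
      exact (hodd.pow).add_one
  have hpos : ∀ n, p ^ n - 1 + 1 = p ^ n := fun n => Nat.sub_add_cancel (Nat.one_le_pow _ _ (by omega))
  have hv1 : v ^ p ^ (2 * s) = -v := by
    rw [← hpos (2 * s), pow_succ, hv]; ring
  have hv2 : v ^ p ^ (4 * s) = v := by
    have : p ^ (4 * s) = p ^ (2 * s) * p ^ (2 * s) := by rw [← pow_add]; congr 1; ring
    rw [this, pow_mul, hv1, Odd.neg_pow hodd.pow, hv1, neg_neg]
  have hv3 : v ^ p ^ (2 * l) = -v := by
    have : p ^ (2 * l) = (p ^ (4 * s)) ^ j * p ^ (2 * s) := by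
      rw [hl, ← pow_mul, ← pow_add]; congr 1; ring
    rw [this, pow_mul, cnt_iter _ _ _ hv2, hv1]
  have hiff : ∀ x : F, (v * x) ^ p ^ (2 * l) + v * x = 0 ↔ x = 0 ∨ x ^ (p ^ (2 * s) - 1) = 1 := by
    intro x
    rcases eq_or_ne x 0 with rfl | hx
    · simp [(Fact.out : p.Prime).ne_zero]
    · have h1 : x ^ (p ^ e - 1) = 1 := by rw [← hF]; exact FiniteField.pow_card_sub_one_eq_one x hx
      have h2 : x ^ (p ^ (2 * s) - 1) = 1 ↔ x ^ (p ^ (2 * l) - 1) = 1 := by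
        rw [← hg, ← Nat.pow_sub_one_gcd_pow_sub_one, pow_gcd_eq_one]
        exact ⟨fun h => h.1, fun h => ⟨h, h1⟩⟩
      rw [h2, mul_pow, hv3]
      have h3 : x ^ p ^ (2 * l) = x ^ (p ^ (2 * l) - 1) * x := by rw [← pow_succ, hpos]
      rw [h3]
      constructor
      · intro h
        right
        have h4 : v * x * (1 - x ^ (p ^ (2 * l) - 1)) = 0 := by linear_combination h
        have := (mul_eq_zero.1 h4).resolve_left (mul_ne_zero hv0 hx)
        exact (sub_eq_zero.1 this).symm
      · rintro (h | h)
        · exact absurd h hx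
        · rw [h]; ring
  have hc : (Finset.univ.filter (fun x : F => x ^ p ^ (2 * l) + x = 0)).card =
      (insert 0 (Finset.univ.filter (fun x : F => x ^ (p ^ (2 * s) - 1) = 1))).card := by
    refine Finset.card_bij' (fun x _ => v⁻¹ * x) (fun x _ => v * x) ?_ ?_ ?_ ?_
    · intro x hx
      simp only [Finset.mem_filter, Finset.mem_univ, true_and, Finset.mem_insert] at hx ⊢
      rw [← hiff, mul_inv_cancel_left₀ hv0, hx]
    · intro x hx
      simp only [Finset.mem_filter, Finset.mem_univ, true_and, Finset.mem_insert] at hx ⊢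
      rwa [hiff]
    · intro x _; simp [hv0]
    · intro x _; simp [hv0]
  have hs0 : s ≠ 0 := by
    rintro rfl
    have h5 := Fintype.one_lt_card (α := F)
    rw [hF, he] at h5
    simp at h5
  have hlt : 1 < p ^ (2 * s) := Nat.one_lt_pow (by omega) hp1
  rw [hc, Finset.card_insert_of_notMem, cnt_unity _ (by rw [hF]; exact hdvd), hpos]
  simp only [Finset.mem_filter, Finset.mem_univ, true_and]
  rw [zero_pow (by omega)]
  simp

theorem sum_const0 (f : ZMod p → ℤ) (A : ℤ) (h : ∀ c, c ≠ 0 → f c = A) :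
    ∑ c, f c = f 0 + ((p : ℤ) - 1) * A := by
  rw [← Finset.add_sum_erase _ _ (Finset.mem_univ (0 : ZMod p))]
  congr 1
  rw [Finset.sum_congr rfl (fun c hc => h c (Finset.ne_of_mem_erase hc)), Finset.sum_const,
    Finset.card_erase_of_mem (Finset.mem_univ _), Finset.card_univ, ZMod.card, nsmul_eq_mul,
    Nat.cast_sub (Fact.out : p.Prime).one_le, Nat.cast_one]

/-- count of `Q = c` -/
noncomputable def NQ (p : ℕ) [Fact p.Prime] (l : ℕ) (F : Type*) [Field F] [Fintype F]
    [Algebra (ZMod p) F] (c : ZMod p) : ℕ := (Finset.univ.filter (fun x : F => QF p l x = c)).card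

theorem total_cnt (l : ℕ) : ∑ c, (NQ p l F c : ℤ) = Fintype.card F := by
  rw [← Finset.card_univ, Finset.card_eq_sum_card_fiberwise (f := QF p l) (t := Finset.univ)
    (by intro x _; simp)]
  push_cast
  rfl

theorem lin_cnt (A : F) (hA : A ≠ 0) (t : ZMod p) :
    p * (Finset.univ.filter (fun x : F => TR p F (A * x) = t)).card = Fintype.card F := by
  have h1 : ∃ u, TR p F (A * u) ≠ 0 := by
    by_contra h
    push Not at h
    exact hA (TR_nondeg A h)
  obtain ⟨u, hu⟩ := h1
  have := cnt_trans (fun _ : F => True) ((TR p F).comp (LinearMap.mulLeft (ZMod p) A)) u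
    (by simpa using hu) (fun _ _ _ => trivial) t
  simpa using this

theorem second_moment (hp2 : p ≠ 2) (l : ℕ) :
    (p : ℤ) * ∑ c, (NQ p l F c : ℤ) ^ 2 =
      p * ((Finset.univ.filter (fun x : F => x ^ p ^ (2 * l) + x = 0)).card * Fintype.card F) +
      (Fintype.card F - (Finset.univ.filter (fun x : F => x ^ p ^ (2 * l) + x = 0)).card) *
        Fintype.card F := by
  have h1 : ∑ c, (NQ p l F c : ℤ) ^ 2 = ∑ x : F, (NQ p l F (QF p l x) : ℤ) := by
    rw [← Finset.sum_fiberwise Finset.univ (QF p l) (fun x : F => (NQ p l F (QF p l x) : ℤ))]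
    refine Finset.sum_congr rfl (fun c _ => ?_)
    trans ∑ x ∈ Finset.univ.filter (fun x : F => QF p l x = c), (NQ p l F c : ℤ)
    · rw [Finset.sum_const, nsmul_eq_mul, sq]; rfl
    · refine Finset.sum_congr rfl (fun x hx => ?_)
      rw [(Finset.mem_filter.1 hx).2]
  have h2 : ∀ x : F, (NQ p l F (QF p l x) : ℤ) =
      ∑ h : F, if QF p l (x + h) = QF p l x then (1 : ℤ) else 0 := by
    intro x
    unfold NQ
    rw [Finset.card_filter]
    push_cast
    exact (Equiv.sum_comp (Equiv.addLeft x) (fun y => if QF p l y = QF p l x then (1 : ℤ) else 0)).symm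
  have h3 : ∀ h : F, (p : ℤ) * ∑ x : F, (if QF p l (x + h) = QF p l x then (1 : ℤ) else 0) =
      if h ^ p ^ (2 * l) + h = 0 then (p : ℤ) * Fintype.card F else Fintype.card F := by
    intro h
    split_ifs with hr
    · have : ∀ x : F, QF p l (x + h) = QF p l x := by
        intro x
        rw [QF_add, QF_rad hp2 l h hr, hr]; simp
      simp [this]
    · have hiff : ∀ x : F, QF p l (x + h) = QF p l x ↔
          TR p F ((h ^ p ^ (2 * l) + h) * x ^ p ^ l) = - QF p l h := by
        intro x
        rw [QF_add, mul_comm (x ^ p ^ l)]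
        constructor
        · intro h'; linear_combination h'
        · intro h'; linear_combination h'
      simp only [hiff]
      have : CharP F p := charP_of_injective_algebraMap (algebraMap (ZMod p) F).injective p
      have h5 := (iterateFrobeniusEquiv F p l).toEquiv.sum_comp (fun y : F =>
        if TR p F ((h ^ p ^ (2 * l) + h) * y) = - QF p l h then (1 : ℤ) else 0)
      have h6 : ∀ x : F, (iterateFrobeniusEquiv F p l).toEquiv x = x ^ p ^ l := fun x => by
        simp [iterateFrobenius_def]
      simp only [h6] at h5
      rw [h5]
      have := lin_cnt (p := p) _ hr (- QF p l h)
      rw [Finset.card_filter] at this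
      exact_mod_cast this
  rw [h1, Finset.sum_congr rfl (fun x _ => h2 x), Finset.sum_comm, Finset.mul_sum,
    Finset.sum_congr rfl (fun x _ => h3 x), Finset.sum_ite, Finset.sum_const, Finset.sum_const]
  have h7 : ((Finset.univ.filter (fun x : F => ¬ (x ^ p ^ (2 * l) + x = 0))).card : ℤ) =
      Fintype.card F - (Finset.univ.filter (fun x : F => x ^ p ^ (2 * l) + x = 0)).card := by
    rw [← Finset.card_univ, ← Finset.card_filter_add_card_filter_not (s := Finset.univ) (fun x : F => x ^ p ^ (2 * l) + x = 0)]
    push_cast; ring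
  rw [nsmul_eq_mul, nsmul_eq_mul, h7]
  ring

theorem main_cnt (hp2 : p ≠ 2) (e l s k j : ℕ) (hF : Fintype.card F = p ^ e)
    (hl : l = s * (2 * j + 1)) (he : e = 2 * s * k) (hk : Even k)
    (hg : Nat.gcd (2 * l) e = 2 * s) :
    (p : ℤ) * NQ p l F 1 = p ^ e + p ^ (s * k + s) ∧
    ∀ c, (NQ p l F c : ℤ) = NQ p l F 1 - if c = 0 then (p : ℤ) ^ (s * k + s) else 0 := by
  have hp1 : 1 < p := (Fact.out : p.Prime).one_lt
  have hc : ∀ c : ZMod p, c ≠ 0 → NQ p l F c = NQ p l F 1 := fun c hc =>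
    QF_const e l s k j hF hl he c hc
  have hc' : ∀ c : ZMod p, c ≠ 0 → (NQ p l F c : ℤ) = NQ p l F 1 := fun c h => by rw [hc c h]
  have h1 := total_cnt (p := p) (F := F) l
  have h2 := second_moment (p := p) (F := F) hp2 l
  rw [sum_const0 _ (NQ p l F 1 : ℤ) (fun c h => by rw [hc c h])] at h1
  rw [sum_const0 _ ((NQ p l F 1 : ℤ) ^ 2) (fun c h => by rw [hc c h]),
    rad_card hp2 e l s k j hF hl he hk hg] at h2
  obtain ⟨D, hD⟩ := QF_dvd (F := F) e l s k j hF hl he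
  change NQ p l F 1 = _ at hD
  rw [hF] at h1 h2
  have hD' : (NQ p l F 1 : ℤ) = ((p : ℤ) ^ s + 1) * D := by rw [hD]; push_cast; ring
  generalize (NQ p l F 1 : ℤ) = M at *
  generalize hM0 : (NQ p l F 0 : ℤ) = M0 at *
  have hp0 : (p : ℤ) - 1 ≠ 0 := by
    have : (1 : ℤ) < p := by exact_mod_cast hp1
    linarith
  push_cast at h1 h2
  have hS : (M0 - M) ^ 2 = ((p : ℤ) ^ (s * k + s)) ^ 2 := by
    have e1 : ((p : ℤ) ^ (s * k + s)) ^ 2 = (p : ℤ) ^ e * (p : ℤ) ^ (2 * s) := by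
      rw [← pow_mul, ← pow_add, he]; congr 1; ring
    rw [e1]
    apply mul_left_cancel₀ hp0
    rw [← h1] at h2 ⊢
    linear_combination h2
  have hS2 : M0 - M = - (p : ℤ) ^ (s * k + s) := by
    rcases sq_eq_sq_iff_eq_or_eq_neg.1 hS with h | h
    · exfalso
      have hmod : ((p : ℤ) ^ s + 1) ∣ 2 := by
        have hm1 : (p : ℤ) ^ s ≡ -1 [ZMOD ((p : ℤ) ^ s + 1)] := by
          rw [Int.modEq_iff_dvd]; exact ⟨-1, by ring⟩
        have hmk : (p : ℤ) ^ (s * k) ≡ 1 [ZMOD ((p : ℤ) ^ s + 1)] := by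
          rw [pow_mul]; have := hm1.pow k; rwa [hk.neg_one_pow] at this
        have he1 : (p : ℤ) ^ e ≡ 1 [ZMOD ((p : ℤ) ^ s + 1)] := by
          have : (p : ℤ) ^ e = (p : ℤ) ^ (s * k) * (p : ℤ) ^ (s * k) := by
            rw [he, ← pow_add]; congr 1; ring
          rw [this]; simpa using hmk.mul hmk
        have hms : (p : ℤ) ^ (s * k + s) ≡ -1 [ZMOD ((p : ℤ) ^ s + 1)] := by
          rw [pow_add]; simpa using hmk.mul hm1
        have hf : (p : ℤ) ^ e - (p : ℤ) ^ (s * k + s) ≡ 2 [ZMOD ((p : ℤ) ^ s + 1)] := by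
          simpa using he1.sub hms
        have hz : (p : ℤ) ^ e - (p : ℤ) ^ (s * k + s) ≡ 0 [ZMOD ((p : ℤ) ^ s + 1)] := by
          rw [Int.modEq_zero_iff_dvd]
          exact ⟨p * D, by rw [← h1, ← h]; linear_combination (p : ℤ) * hD'⟩
        exact (Int.modEq_zero_iff_dvd).1 (hf.symm.trans hz)
      have hs0 : s ≠ 0 := by
        rintro rfl
        have h5 := Fintype.one_lt_card (α := F)
        rw [hF, he] at h5
        simp at h5
      have hlt : (1 : ℤ) < (p : ℤ) ^ s := one_lt_pow₀ (by exact_mod_cast hp1) hs0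
      have := Int.le_of_dvd (by norm_num) hmod
      linarith
    · exact h
  refine ⟨by rw [← h1]; linear_combination -hS2, fun c => ?_⟩
  split_ifs with h
  · subst h; rw [hM0]; linear_combination hS2
  · rw [hc' c h, sub_zero]

/-- joint count -/
noncomputable def FQ (p : ℕ) [Fact p.Prime] (l : ℕ) {F : Type*} [Field F] [Fintype F]
    [Algebra (ZMod p) F] (a : F) (t : ZMod p) : ℕ :=
  (Finset.univ.filter (fun x : F => QF p l x = 1 ∧ TR p F (a * x) = t)).card

/-- number of roots -/
noncomputable def rts (p : ℕ) [Fact p.Prime] (g t : ZMod p) : ℕ :=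
  (Finset.univ.filter (fun y : ZMod p => 1 + y * t + y ^ 2 * g = 0)).card

theorem FQ_nonsolv (l : ℕ) (hp2 : p ≠ 2) (a : F)
    (hno : ¬ ∃ x : F, x ^ p ^ (2 * l) + x = -a ^ p ^ l) (t : ZMod p) :
    p * FQ p l a t = NQ p l F 1 := by
  obtain ⟨d, hd, hd2⟩ := nonsolv l a hno
  have := cnt_trans (fun x : F => QF p l x = 1) ((TR p F).comp (LinearMap.mulLeft (ZMod p) a)) d
    (by simpa using hd2) (fun x k hx => by
      rw [QF_add, A_smul, hd, QF_smul, QF_rad hp2 l d hd, hx]; simp) t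
  unfold FQ NQ
  convert this using 1
  · congr 2; ext x; simp only [Finset.mem_filter, Finset.mem_univ, true_and]; rfl
  · congr 1; ext x; simp

theorem FQ_solv (l : ℕ) (a : F) (ha : a ≠ 0) (γ : F)
    (hγ : γ ^ p ^ (2 * l) + γ = -a ^ p ^ l) (t : ZMod p) (E : ℤ)
    (hN : ∀ c, (NQ p l F c : ℤ) = NQ p l F 1 - if c = 0 then E else 0) :
    (p : ℤ) * (p * FQ p l a t + Fintype.card F) =
      Fintype.card F + p * (p * NQ p l F 1 - E * rts p (QF p l γ) t) := by
  have hQ : ∀ (x : F) (y : ZMod p), QF p l (x + (-y) • γ) =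
      QF p l x + y ^ 2 * QF p l γ + y * TR p F (a * x) := by
    intro x y
    rw [QF_add, QF_smul, A_smul, hγ, ← TR_frob (a * x) l, ← smul_eq_mul y, ← map_smul, mul_pow]
    rw [neg_sq]
    congr 2
    rw [neg_smul, smul_neg, neg_neg, mul_smul_comm, mul_comm]
  have hline : ∀ y : ZMod p,
      (∑ x : F, if QF p l x + y * TR p F (a * x) = 1 + y * t then (1 : ℤ) else 0) =
      NQ p l F (1 + y * t + y ^ 2 * QF p l γ) := by
    intro y
    unfold NQ
    rw [Finset.card_filter]
    push_cast
    rw [← Equiv.sum_comp (Equiv.addRight ((-y) • γ))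
      (fun x : F => if QF p l x = 1 + y * t + y ^ 2 * QF p l γ then (1 : ℤ) else 0)]
    refine Finset.sum_congr rfl (fun x _ => ?_)
    rw [Equiv.coe_addRight, hQ]
    congr 1
    apply propext
    constructor
    · intro h; linear_combination h
    · intro h; linear_combination h
  have hpt : ∀ x : F,
      (∑ y : ZMod p, if QF p l x + y * TR p F (a * x) = 1 + y * t then (1 : ℤ) else 0) =
      1 + (if QF p l x = 1 ∧ TR p F (a * x) = t then (p : ℤ) else 0) -
        if TR p F (a * x) = t then 1 else 0 := by
    intro x
    by_cases h : TR p F (a * x) = t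
    · simp only [h, add_left_inj, and_true, if_true]
      by_cases h1 : QF p l x = 1
      · simp [h1, ZMod.card]
      · simp [h1]
    · simp only [h, and_false, if_false]
      have h2 : TR p F (a * x) - t ≠ 0 := sub_ne_zero.2 h
      have : ∀ y : ZMod p, QF p l x + y * TR p F (a * x) = 1 + y * t ↔
          y = (1 - QF p l x) / (TR p F (a * x) - t) := by
        intro y
        rw [eq_div_iff h2]
        constructor
        · intro h; linear_combination h
        · intro h; linear_combination h
      simp only [this]
      simp
  have hsum : ∑ y : ZMod p, (NQ p l F (1 + y * t + y ^ 2 * QF p l γ) : ℤ) =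
      Fintype.card F + p * FQ p l a t -
        (Finset.univ.filter (fun x : F => TR p F (a * x) = t)).card := by
    rw [Finset.sum_congr rfl (fun y _ => (hline y).symm), Finset.sum_comm,
      Finset.sum_congr rfl (fun x _ => hpt x), Finset.sum_sub_distrib, Finset.sum_add_distrib]
    unfold FQ
    rw [Finset.card_filter, Finset.card_filter]
    push_cast
    rw [Finset.mul_sum]
    simp
  have hsum2 : ∑ y : ZMod p, (NQ p l F (1 + y * t + y ^ 2 * QF p l γ) : ℤ) =
      p * NQ p l F 1 - E * rts p (QF p l γ) t := by
    rw [Finset.sum_congr rfl (fun y _ => hN _), Finset.sum_sub_distrib]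
    unfold rts
    rw [Finset.card_filter]
    push_cast
    rw [Finset.mul_sum]
    simp [ZMod.card]
  have h3 := lin_cnt (p := p) a ha t
  have h3' : (p : ℤ) * (Finset.univ.filter (fun x : F => TR p F (a * x) = t)).card =
    Fintype.card F := by exact_mod_cast h3
  rw [← hsum2, hsum]
  linear_combination h3'

theorem T_range (l : ℕ) (a : F) (β : ZMod p) (C : Finset (ZMod p)) :
    p * (Finset.univ.filter (fun x : F × F => TR p F (x.1 ^ (p ^ l + 1)) = 1 ∧ TR p F x.2 ∈ C ∧
      TR p F (a * x.1 + algebraMap (ZMod p) F β * x.2) = 0)).card =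
    Fintype.card F * ∑ c ∈ C, FQ p l a (-(β * c)) := by
  rw [Finset.card_eq_sum_card_fiberwise (f := fun x => TR p F x.2) (t := C) (by
    intro x hx
    simp only [Finset.coe_filter, Finset.mem_univ, true_and, Set.mem_ofPred_eq] at hx
    exact hx.2.1), Finset.mul_sum, Finset.mul_sum]
  refine Finset.sum_congr rfl (fun c hc => ?_)
  have h1 := lin_cnt (p := p) (1 : F) one_ne_zero c
  rw [← h1, mul_assoc]
  congr 1
  unfold FQ
  rw [← Finset.card_product]
  rw [← Finset.card_map (Equiv.prodComm F F).toEmbedding]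
  congr 1
  ext ⟨x, y⟩
  simp only [Finset.mem_filter, Finset.mem_univ, true_and, Finset.mem_product, Finset.mem_map,
    Equiv.coe_toEmbedding, Equiv.prodComm_apply, Prod.exists, Prod.swap_prod_mk, Prod.mk.injEq,
    one_mul]
  constructor
  · rintro ⟨x', y', ⟨⟨h1, h2, h3⟩, h4⟩, rfl, rfl⟩
    refine ⟨h4, h1, ?_⟩
    rw [map_add, ← Algebra.smul_def, map_smul, h4, smul_eq_mul] at h3
    linear_combination h3
  · rintro ⟨h4, h1, h3⟩
    refine ⟨y, x, ⟨⟨h1, by rw [h4]; exact hc, ?_⟩, h4⟩, rfl, rfl⟩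
    rw [map_add, ← Algebra.smul_def, map_smul, h4, smul_eq_mul, h3]; ring

theorem T_other (l : ℕ) (a b : F) (hb : b ∉ Set.range (algebraMap (ZMod p) F))
    (C : Finset (ZMod p)) :
    p ^ 2 * (Finset.univ.filter (fun x : F × F => TR p F (x.1 ^ (p ^ l + 1)) = 1 ∧ TR p F x.2 ∈ C ∧
      TR p F (a * x.1 + b * x.2) = 0)).card =
    NQ p l F 1 * C.card * Fintype.card F := by
  have hu : ∃ u : F, TR p F u = 0 ∧ TR p F (b * u) ≠ 0 := by
    by_contra h
    push Not at h
    obtain ⟨x1, hx1⟩ := Algebra.trace_surjective (ZMod p) F 1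
    change TR p F x1 = 1 at hx1
    apply hb
    refine ⟨TR p F (b * x1), ?_⟩
    symm
    rw [← sub_eq_zero]
    apply TR_nondeg (p := p)
    intro x
    have h1 := h (x - TR p F x • x1) (by rw [map_sub, map_smul, hx1]; simp)
    rw [mul_sub, map_sub, mul_smul_comm, map_smul, smul_eq_mul] at h1
    rw [sub_mul, map_sub, ← Algebra.smul_def, map_smul, smul_eq_mul]
    linear_combination h1
  obtain ⟨u, hu0, hu1⟩ := hu
  have hG : ∀ c t : ZMod p, p ^ 2 *
      (Finset.univ.filter (fun x : F => TR p F x = c ∧ TR p F (b * x) = t)).card =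
      Fintype.card F := by
    intro c t
    have h1 := cnt_trans (fun x : F => TR p F x = c) ((TR p F).comp (LinearMap.mulLeft (ZMod p) b))
      u (by simpa using hu1) (fun x k hx => by rw [map_add, map_smul, hu0, hx]; simp) t
    have h2 := lin_cnt (p := p) (1 : F) one_ne_zero c
    simp only [one_mul] at h2
    rw [← h2, sq, mul_assoc]
    congr 1
    convert h1 using 1
    · congr 2; ext x; simp only [Finset.mem_filter, Finset.mem_univ, true_and]; rfl
    · congr 1; ext x; simp
  rw [Finset.card_eq_sum_card_fiberwise (f := fun x => (x.1, TR p F x.2))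
    (t := (Finset.univ.filter (fun x : F => QF p l x = 1)) ×ˢ C) (by
    intro x hx
    simp only [Finset.coe_filter, Finset.mem_univ, true_and, Set.mem_ofPred_eq] at hx
    simp only [Finset.coe_product, Set.mem_prod, Finset.mem_coe, Finset.mem_filter,
      Finset.mem_univ, true_and]
    exact ⟨hx.1, hx.2.1⟩), Finset.mul_sum]
  have hterm : ∀ z ∈ (Finset.univ.filter (fun x : F => QF p l x = 1)) ×ˢ C,
      p ^ 2 * (Finset.filter (fun x : F × F => (x.1, TR p F x.2) = z)
        (Finset.univ.filter (fun x : F × F => TR p F (x.1 ^ (p ^ l + 1)) = 1 ∧ TR p F x.2 ∈ C ∧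
      TR p F (a * x.1 + b * x.2) = 0))).card = Fintype.card F := by
    rintro ⟨x1, c⟩ hz
    simp only [Finset.mem_product, Finset.mem_filter, Finset.mem_univ, true_and] at hz
    rw [← hG c (- TR p F (a * x1))]
    congr 1
    refine Finset.card_bij' (fun x _ => x.2) (fun x _ => (x1, x)) ?_ ?_ ?_ ?_
    · rintro ⟨x, y⟩ hx
      simp only [Finset.mem_filter, Finset.mem_univ, true_and, Prod.mk.injEq] at hx ⊢
      obtain ⟨⟨h1, h2, h3⟩, rfl, h4⟩ := hx
      rw [map_add] at h3
      exact ⟨h4, by linear_combination h3⟩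
    · intro y hy
      simp only [Finset.mem_filter, Finset.mem_univ, true_and, Prod.mk.injEq] at hy ⊢
      refine ⟨⟨hz.1, by rw [hy.1]; exact hz.2, ?_⟩, hy.1⟩
      rw [map_add, hy.2]; ring
    · rintro ⟨x, y⟩ hx
      simp only [Finset.mem_filter, Finset.mem_univ, true_and, Prod.mk.injEq] at hx ⊢
      exact ⟨hx.2.1.symm, trivial⟩
    · intro y _; rfl
  rw [Finset.sum_congr rfl hterm, Finset.sum_const, Finset.card_product, smul_eq_mul]
  rfl

theorem neg_sq_iff (hp : p % 4 = 3) (x : ZMod p) (hx : x ≠ 0) : IsSquare (-x) ↔ ¬ IsSquare x := by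
  have hm : ¬ IsSquare (-1 : ZMod p) := by
    rw [ZMod.exists_sq_eq_neg_one_iff]; omega
  have h2 : ringChar (ZMod p) ≠ 2 := by
    rw [ZMod.ringChar_zmod_n]; omega
  have h1 : quadraticChar (ZMod p) (-1) = -1 := quadraticChar_neg_one_iff_not_isSquare.2 hm
  rw [← quadraticChar_neg_one_iff_not_isSquare,
    ← quadraticChar_one_iff_isSquare (neg_ne_zero.2 hx), ← neg_one_mul, map_mul, h1]
  constructor <;> intro h <;> linarith

theorem cyc_neg (hp : p % 4 = 3) (i : ℕ) (hi : i ≤ 1) (x : ZMod p) :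
    -x ∈ cyc p i ↔ x ∈ cyc p (1 - i) := by
  unfold cyc
  simp only [Finset.mem_filter, Finset.mem_univ, true_and, ne_eq, neg_eq_zero]
  refine and_congr_right (fun hx => ?_)
  have := neg_sq_iff hp x hx
  interval_cases i
  · simp [this]
  · simp [this]

theorem cyc_or (i : ℕ) (hi : i ≤ 1) (x : ZMod p) :
    x ≠ 0 ↔ x ∈ cyc p i ∨ x ∈ cyc p (1 - i) := by
  unfold cyc
  simp only [Finset.mem_filter, Finset.mem_univ, true_and]
  interval_cases i <;> simp <;> tauto

theorem cyc_disj (i : ℕ) (hi : i ≤ 1) (x : ZMod p) (h : x ∈ cyc p i) : x ∉ cyc p (1 - i) := by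
  unfold cyc at *
  simp only [Finset.mem_filter, Finset.mem_univ, true_and] at *
  interval_cases i <;> simp at * <;> tauto

theorem odd_cnt (hp : p % 4 = 3) (i : ℕ) (hi : i ≤ 1) (h : ZMod p → ZMod p)
    (ho : ∀ y, h (-y) = - h y) :
    2 * (Finset.univ.filter (fun y => h y ∈ cyc p i)).card =
      (Finset.univ.filter (fun y => h y ≠ 0)).card := by
  have h1 : (Finset.univ.filter (fun y => h y ∈ cyc p i)).card =
      (Finset.univ.filter (fun y => h y ∈ cyc p (1 - i))).card := by
    refine Finset.card_bij' (fun y _ => -y) (fun y _ => -y) ?_ ?_ ?_ ?_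
    · intro y hy
      simp only [Finset.mem_filter, Finset.mem_univ, true_and] at hy ⊢
      rw [← cyc_neg hp i hi, ho, neg_neg]; exact hy
    · intro y hy
      simp only [Finset.mem_filter, Finset.mem_univ, true_and] at hy ⊢
      rw [ho, cyc_neg hp i hi]; exact hy
    · intro y _; simp
    · intro y _; simp
  have h2 : Finset.univ.filter (fun y => h y ≠ 0) =
      (Finset.univ.filter (fun y => h y ∈ cyc p i)) ∪
      (Finset.univ.filter (fun y => h y ∈ cyc p (1 - i))) := by
    ext y
    simp only [Finset.mem_filter, Finset.mem_univ, true_and, Finset.mem_union]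
    exact cyc_or i hi _
  rw [h2, Finset.card_union_of_disjoint, ← h1, two_mul]
  rw [Finset.disjoint_left]
  intro y hy hy'
  simp only [Finset.mem_filter, Finset.mem_univ, true_and] at hy hy'
  exact cyc_disj i hi _ hy hy'

theorem cyc_card (hp : p % 4 = 3) (i : ℕ) (hi : i ≤ 1) : 2 * ((cyc p i).card : ℤ) = p - 1 := by
  have h1 := odd_cnt hp i hi id (fun _ => rfl)
  simp only [id] at h1
  have h2 : (Finset.univ.filter (fun y : ZMod p => y ≠ 0)).card + 1 = p := by
    rw [Finset.filter_ne', Finset.card_erase_of_mem (Finset.mem_univ _), Finset.card_univ, ZMod.card]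
    exact Nat.sub_add_cancel (Fact.out : p.Prime).one_le
  have h3 : Finset.univ.filter (fun y => y ∈ cyc p i) = cyc p i := by ext; simp
  rw [h3] at h1
  omega

theorem rts_zero (hp : p % 4 = 3) (g : ZMod p) (hg : g = 0 ∨ g ∈ cyc p 0) : rts p g 0 = 0 := by
  unfold rts
  rw [Finset.card_eq_zero, Finset.filter_eq_empty_iff]
  intro y _ hy
  rw [mul_zero, add_zero] at hy
  rcases hg with rfl | hg
  · simp at hy
  · simp only [cyc, Finset.mem_filter, Finset.mem_univ, true_and, if_true] at hg
    obtain ⟨_, w, rfl⟩ := hg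
    have hm : ¬ IsSquare (-1 : ZMod p) := by
      rw [ZMod.exists_sq_eq_neg_one_iff]; omega
    exact hm ⟨y * w, by linear_combination -hy⟩

theorem rts_two (hp : p % 4 = 3) (g : ZMod p) (hg : g ∈ cyc p 1) : rts p g 0 = 2 := by
  unfold rts
  simp only [cyc, Finset.mem_filter, Finset.mem_univ, true_and] at hg
  obtain ⟨h0, h1⟩ := hg
  simp only [one_ne_zero, if_false] at h1
  obtain ⟨w, hw⟩ := (neg_sq_iff hp g h0).2 h1
  have hw0 : w ≠ 0 := by rintro rfl; simp at hw; exact h0 hw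
  have h2 : (2 : ZMod p) ≠ 0 := by
    intro h
    have h' : ((2 : ℕ) : ZMod p) = 0 := by exact_mod_cast h
    rw [ZMod.natCast_eq_zero_iff] at h'
    have := (Nat.prime_dvd_prime_iff_eq (Fact.out : p.Prime) Nat.prime_two).1 h'
    omega
  rw [Finset.card_eq_two]
  refine ⟨w⁻¹, -w⁻¹, ?_, ?_⟩
  · intro h
    have : (2 : ZMod p) * w⁻¹ = 0 := by linear_combination h
    rcases mul_eq_zero.1 this with h | h
    · exact h2 h
    · exact inv_ne_zero hw0 h
  · ext y
    simp only [Finset.mem_filter, Finset.mem_univ, true_and, Finset.mem_insert,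
      Finset.mem_singleton]
    constructor
    · intro h
      have h3 : (y * w - 1) * (y * w + 1) = 0 := by linear_combination -h - y ^ 2 * hw
      rcases mul_eq_zero.1 h3 with h | h
      · left; apply eq_inv_of_mul_eq_one_left; linear_combination h
      · right; rw [neg_inv]; apply eq_inv_of_mul_eq_one_left; linear_combination -h
    · have h4 : w * w⁻¹ = 1 := mul_inv_cancel₀ hw0
      have hgw : g = - (w * w) := by linear_combination -hw
      rintro (rfl | rfl) <;> rw [hgw] <;> linear_combination (-1 - w * w⁻¹) * h4

theorem rts_sum (hp : p % 4 = 3) (i : ℕ) (hi : i ≤ 1) (g β : ZMod p) (hβ : β ≠ 0) :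
    2 * ∑ c ∈ cyc p i, (rts p g (-(β * c)) : ℤ) = p - 1 - rts p g 0 := by
  set h : ZMod p → ZMod p := fun y => (1 + y ^ 2 * g) / (y * β) with hh
  have ho : ∀ y, h (-y) = - h y := by
    intro y
    simp only [hh]
    rw [neg_sq, neg_mul, div_neg]
  have h1 := odd_cnt hp i hi h ho
  rw [Finset.card_eq_sum_card_fiberwise (f := h) (t := cyc p i) (by
    intro x hx
    simpa using hx)] at h1
  have h2 : ∀ c ∈ cyc p i, ((Finset.univ.filter (fun y => h y ∈ cyc p i)).filter
      (fun y => h y = c)).card = rts p g (-(β * c)) := by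
    intro c hc
    have hc0 : c ≠ 0 := (cyc_or i hi c).2 (Or.inl hc)
    unfold rts
    congr 1
    ext y
    simp only [Finset.mem_filter, Finset.mem_univ, true_and, hh]
    rcases eq_or_ne y 0 with rfl | hy
    · simp [hc0.symm]
    · have hyb : y * β ≠ 0 := mul_ne_zero hy hβ
      constructor
      · rintro ⟨_, h3⟩
        rw [div_eq_iff hyb] at h3
        linear_combination h3
      · intro h3
        have h4 : (1 + y ^ 2 * g) / (y * β) = c := by
          rw [div_eq_iff hyb]; linear_combination h3
        exact ⟨by rw [h4]; exact hc, h4⟩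
  rw [Finset.sum_congr rfl h2] at h1
  have h5 : (Finset.univ.filter (fun y => h y ≠ 0)).card + rts p g 0 + 1 = p := by
    have e1 : ((Finset.univ : Finset (ZMod p)).erase 0).card + 1 = p := by
      rw [Finset.card_erase_of_mem (Finset.mem_univ _), Finset.card_univ, ZMod.card]
      exact Nat.sub_add_cancel (Fact.out : p.Prime).one_le
    have e2 := Finset.card_filter_add_card_filter_not (s := (Finset.univ : Finset (ZMod p)).erase 0)
      (fun y => h y ≠ 0)
    have e3 : ((Finset.univ : Finset (ZMod p)).erase 0).filter (fun y => h y ≠ 0) =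
        Finset.univ.filter (fun y => h y ≠ 0) := by
      ext y
      simp only [Finset.mem_filter, Finset.mem_erase, Finset.mem_univ, and_true, true_and]
      refine ⟨fun h => h.2, fun h' => ⟨?_, h'⟩⟩
      rintro rfl
      simp [hh] at h'
    have e4 : ((Finset.univ : Finset (ZMod p)).erase 0).filter (fun y => ¬ h y ≠ 0) =
        Finset.univ.filter (fun y : ZMod p => 1 + y * 0 + y ^ 2 * g = 0) := by
      ext y
      simp only [Finset.mem_filter, Finset.mem_erase, Finset.mem_univ, and_true, true_and, not_not,
        mul_zero, add_zero, hh]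
      rcases eq_or_ne y 0 with rfl | hy
      · simp
      · simp [hy, hβ]
    rw [e3, e4] at e2
    unfold rts
    omega
  have h6 : 2 * ∑ c ∈ cyc p i, (rts p g (-(β * c)) : ℤ) =
      (Finset.univ.filter (fun y => h y ≠ 0)).card := by exact_mod_cast h1
  rw [h6]
  omega

theorem Tcount_filter (p e l : ℕ) [Fact p.Prime] [Fintype (GaloisField p e)] (i : ℕ)
    (a b : GaloisField p e) : Tcount p e l i a b =
    (Finset.univ.filter (fun x : GaloisField p e × GaloisField p e =>
      TR p (GaloisField p e) (x.1 ^ (p ^ l + 1)) = 1 ∧ TR p (GaloisField p e) x.2 ∈ cyc p i ∧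
      TR p (GaloisField p e) (a * x.1 + b * x.2) = 0)).card := by
  unfold Tcount
  rw [Nat.card_eq_fintype_card, Fintype.card_subtype]
  rfl

end Helpers

/-- the values of `T_i(a,b)` when `m/s` is even (paper Lemma 16). -/
theorem Tcount_eval_even (p e l m s : ℕ) [Fact p.Prime] (hp : p % 4 = 3)
    (hl : 0 < l) (hm : 1 ≤ m) (he : e = 2 * m) (hs : s = Nat.gcd l e)
    (hsm : s ∣ m) (heven : Even (m / s)) :
    ∀ i ≤ 1, ∀ a b : GaloisField p e,
      (a = 0 → b = 0 →
        (Tcount p e l i a b : ℚ) =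
          ((p : ℚ) - 1) / 2 * ((p : ℚ) ^ (2 * e - 2) + (p : ℚ) ^ (e + m + s - 2))) ∧
      (a = 0 → b ≠ 0 → b ∈ Set.range (algebraMap (ZMod p) (GaloisField p e)) →
        Tcount p e l i a b = 0) ∧
      (a = 0 → b ≠ 0 → b ∉ Set.range (algebraMap (ZMod p) (GaloisField p e)) →
        (Tcount p e l i a b : ℚ) =
          ((p : ℚ) - 1) / 2 * ((p : ℚ) ^ (2 * e - 3) + (p : ℚ) ^ (e + m + s - 3))) ∧
      (a ≠ 0 → b = 0 →
        ((¬ ∃ x : GaloisField p e, x ^ p ^ (2 * l) + x = -a ^ p ^ l) →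
          (Tcount p e l i a b : ℚ) =
            ((p : ℚ) - 1) / 2 * ((p : ℚ) ^ (2 * e - 3) + (p : ℚ) ^ (e + m + s - 3))) ∧
        ∀ γ : GaloisField p e, γ ^ p ^ (2 * l) + γ = -a ^ p ^ l →
          ((tr p e (γ ^ (p ^ l + 1)) = 0 ∨ tr p e (γ ^ (p ^ l + 1)) ∈ cyc p 0) →
            (Tcount p e l i a b : ℚ) =
              ((p : ℚ) - 1) / 2 * ((p : ℚ) ^ (2 * e - 3) + (p : ℚ) ^ (e + m + s - 2))) ∧
          (tr p e (γ ^ (p ^ l + 1)) ∈ cyc p 1 →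
            (Tcount p e l i a b : ℚ) =
              ((p : ℚ) - 1) / 2 * ((p : ℚ) ^ (2 * e - 3) - (p : ℚ) ^ (e + m + s - 2)))) ∧
      (a ≠ 0 → b ≠ 0 → b ∈ Set.range (algebraMap (ZMod p) (GaloisField p e)) →
        ((¬ ∃ x : GaloisField p e, x ^ p ^ (2 * l) + x = -a ^ p ^ l) →
          (Tcount p e l i a b : ℚ) =
            ((p : ℚ) - 1) / 2 * ((p : ℚ) ^ (2 * e - 3) + (p : ℚ) ^ (e + m + s - 3))) ∧
        ∀ γ : GaloisField p e, γ ^ p ^ (2 * l) + γ = -a ^ p ^ l →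
          ((tr p e (γ ^ (p ^ l + 1)) = 0 ∨ tr p e (γ ^ (p ^ l + 1)) ∈ cyc p 0) →
            (Tcount p e l i a b : ℚ) = ((p : ℚ) - 1) / 2 * (p : ℚ) ^ (2 * e - 3)) ∧
          (tr p e (γ ^ (p ^ l + 1)) ∈ cyc p 1 →
            (Tcount p e l i a b : ℚ) =
              ((p : ℚ) - 1) / 2 * (p : ℚ) ^ (2 * e - 3) + (p : ℚ) ^ (e + m + s - 2))) ∧
      (a ≠ 0 → b ≠ 0 → b ∉ Set.range (algebraMap (ZMod p) (GaloisField p e)) →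
        (Tcount p e l i a b : ℚ) =
          ((p : ℚ) - 1) / 2 * ((p : ℚ) ^ (2 * e - 3) + (p : ℚ) ^ (e + m + s - 3))) := by
  intro i hi a b
  letI : Fintype (GaloisField p e) := Fintype.ofFinite _
  have hp2 : p ≠ 2 := by omega
  have hp1 : 1 < p := (Fact.out : p.Prime).one_lt
  have hs0 : 0 < s := by rw [hs]; exact Nat.gcd_pos_of_pos_left _ hl
  obtain ⟨k, hk⟩ := hsm
  have hkk : m / s = k := by rw [hk]; exact Nat.mul_div_cancel_left _ hs0
  rw [hkk] at heven
  obtain ⟨l', hl'⟩ : s ∣ l := by rw [hs]; exact Nat.gcd_dvd_left _ _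
  have hodd : Odd l' := by
    by_contra hne
    rw [Nat.not_odd_iff_even] at hne
    obtain ⟨r, hr⟩ := hne
    have h1 : 2 * s ∣ Nat.gcd l e := by
      apply Nat.dvd_gcd
      · exact ⟨r, by rw [hl', hr]; ring⟩
      · exact ⟨k, by rw [he, hk]; ring⟩
    rw [← hs] at h1
    have := Nat.le_of_dvd hs0 h1
    omega
  obtain ⟨j, hj⟩ := hodd
  have hg : Nat.gcd (2 * l) e = 2 * s := by
    rw [he, Nat.gcd_mul_left]
    congr 1
    apply Nat.dvd_antisymm
    · rw [hs]
      exact Nat.dvd_gcd (Nat.gcd_dvd_left _ _) ((Nat.gcd_dvd_right _ _).trans ⟨2, by rw [he]; ring⟩)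
    · exact Nat.dvd_gcd ⟨l', hl'⟩ ⟨k, hk⟩
  have hF : Fintype.card (GaloisField p e) = p ^ e := by
    rw [← Nat.card_eq_fintype_card]; exact GaloisField.card p e (by omega)
  have hk2 : 2 ≤ k := by
    obtain ⟨r, hr⟩ := heven
    rcases Nat.eq_zero_or_pos r with h | h
    · subst h; simp at hr; subst hr; simp at hk; omega
    · omega
  have he4 : 4 ≤ e := by
    rw [he, hk]; nlinarith
  obtain ⟨hM, hN⟩ := main_cnt (F := GaloisField p e) hp2 e l s k j hF (by rw [hl', hj])
    (by rw [he, hk]; ring) heven hg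
  rw [← hk] at hM hN
  have hC := cyc_card (p := p) hp i hi
  obtain ⟨e', rfl⟩ : ∃ e', e = e' + 3 := ⟨e - 3, by omega⟩
  rw [show 2 * (e' + 3) - 2 = e' + e' + 4 by omega, show 2 * (e' + 3) - 3 = e' + e' + 3 by omega,
    show e' + 3 + m + s - 2 = e' + (m + s) + 1 by omega,
    show e' + 3 + m + s - 3 = e' + (m + s) by omega]
  simp only [pow_add (p : ℚ) (e' + e'), pow_add (p : ℚ) (e' + (m + s)), pow_add (p : ℚ) e' e',
    pow_add (p : ℚ) e' (m + s)]
  rw [pow_add (p : ℤ) e' 3] at hM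
  have hpQ : (p : ℚ) ≠ 0 := by
    have := (Fact.out : p.Prime).ne_zero
    exact_mod_cast this
  have hMQ : (p : ℚ) * NQ p l (GaloisField p (e' + 3)) 1 = p ^ e' * p ^ 3 + p ^ (m + s) := by
    exact_mod_cast hM
  have hCQ : 2 * ((cyc p i).card : ℚ) = p - 1 := by exact_mod_cast hC
  have hFQ : (Fintype.card (GaloisField p (e' + 3)) : ℚ) = p ^ e' * p ^ 3 := by
    rw [hF]; push_cast; ring
  -- the three basic evaluations
  have hother : b ∉ Set.range (algebraMap (ZMod p) (GaloisField p (e' + 3))) →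
      (Tcount p (e' + 3) l i a b : ℚ) =
        ((p : ℚ) - 1) / 2 * ((p : ℚ) ^ e' * p ^ e' * p ^ 3 + p ^ e' * p ^ (m + s)) := by
    intro hb
    have h1 := T_other l a b hb (cyc p i)
    rw [← Tcount_filter] at h1
    have h2 : (p : ℚ) ^ 2 * Tcount p (e' + 3) l i a b =
        NQ p l (GaloisField p (e' + 3)) 1 * (cyc p i).card *
          Fintype.card (GaloisField p (e' + 3)) := by exact_mod_cast h1
    rw [hFQ] at h2
    apply mul_left_cancel₀ (pow_ne_zero 3 hpQ)
    linear_combination p * h2 + (cyc p i).card * ((p : ℚ) ^ e' * p ^ 3) * hMQ +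
      ((p : ℚ) ^ e' * p ^ 3 + p ^ (m + s)) * ((p : ℚ) ^ e' * p ^ 3) / 2 * hCQ
  have hrange : ∀ β : ZMod p, b = algebraMap _ _ β → (p : ℚ) * Tcount p (e' + 3) l i a b =
      (p : ℚ) ^ e' * p ^ 3 * ∑ c ∈ cyc p i, (FQ p l a (-(β * c)) : ℚ) := by
    intro β hb
    have h1 := T_range l a β (cyc p i)
    rw [← hb, ← Tcount_filter] at h1
    rw [← hFQ]
    exact_mod_cast h1
  have hnons : ∀ β : ZMod p, b = algebraMap _ _ β →
      (¬ ∃ x : GaloisField p (e' + 3), x ^ p ^ (2 * l) + x = -a ^ p ^ l) →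
      (Tcount p (e' + 3) l i a b : ℚ) =
        ((p : ℚ) - 1) / 2 * ((p : ℚ) ^ e' * p ^ e' * p ^ 3 + p ^ e' * p ^ (m + s)) := by
    intro β hb hno
    have h1 := hrange β hb
    have h2 : (p : ℚ) * ∑ c ∈ cyc p i, (FQ p l a (-(β * c)) : ℚ) =
        (cyc p i).card * NQ p l (GaloisField p (e' + 3)) 1 := by
      rw [Finset.mul_sum, Finset.sum_congr rfl (g := fun _ => (NQ p l (GaloisField p (e' + 3)) 1 : ℚ)),
        Finset.sum_const, nsmul_eq_mul]
      intro c _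
      exact_mod_cast FQ_nonsolv l hp2 a hno (-(β * c))
    apply mul_left_cancel₀ (pow_ne_zero 3 hpQ)
    linear_combination (p : ℚ) ^ 2 * h1 + (p : ℚ) * ((p : ℚ) ^ e' * p ^ 3) * h2 +
      (cyc p i).card * ((p : ℚ) ^ e' * p ^ 3) * hMQ +
      ((p : ℚ) ^ e' * p ^ 3 + p ^ (m + s)) * ((p : ℚ) ^ e' * p ^ 3) / 2 * hCQ
  have hsolv : a ≠ 0 → ∀ β : ZMod p, b = algebraMap _ _ β →
      ∀ γ : GaloisField p (e' + 3), γ ^ p ^ (2 * l) + γ = -a ^ p ^ l →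
      (p : ℚ) ^ 3 * (Tcount p (e' + 3) l i a b : ℚ) =
        (p : ℚ) ^ e' * p ^ 3 * ((cyc p i).card * ((p : ℚ) ^ e' * p ^ 3 + p * p ^ (m + s)) -
          p * p ^ (m + s) * ∑ c ∈ cyc p i, (rts p (QF p l γ) (-(β * c)) : ℚ)) := by
    intro ha β hb γ hγ
    have h1 := hrange β hb
    have h2 : (p : ℚ) ^ 2 * ∑ c ∈ cyc p i, (FQ p l a (-(β * c)) : ℚ) =
        (cyc p i).card * ((p : ℚ) ^ e' * p ^ 3 + p * p ^ (m + s)) -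
          p * p ^ (m + s) * ∑ c ∈ cyc p i, (rts p (QF p l γ) (-(β * c)) : ℚ) := by
      rw [Finset.mul_sum, Finset.mul_sum, ← nsmul_eq_mul, ← Finset.sum_const,
        ← Finset.sum_sub_distrib]
      refine Finset.sum_congr rfl (fun c _ => ?_)
      have h3 := FQ_solv l a ha γ hγ (-(β * c)) ((p : ℤ) ^ (m + s)) hN
      have h4 : (p : ℚ) * (p * FQ p l a (-(β * c)) + Fintype.card (GaloisField p (e' + 3))) =
          Fintype.card (GaloisField p (e' + 3)) + p * (p * NQ p l (GaloisField p (e' + 3)) 1 -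
            (p : ℚ) ^ (m + s) * rts p (QF p l γ) (-(β * c))) := by exact_mod_cast h3
      rw [hFQ] at h4
      linear_combination h4 + (p : ℚ) * hMQ
    linear_combination (p : ℚ) ^ 2 * h1 + ((p : ℚ) ^ e' * p ^ 3) * h2
  have hF0 : a = 0 → ∀ t : ZMod p, FQ p l a t =
      if t = 0 then NQ p l (GaloisField p (e' + 3)) 1 else 0 := by
    rintro rfl t
    split_ifs with h
    · subst h; simp [FQ, NQ]
    · simp [FQ, Ne.symm h]
  refine ⟨?_, ?_, ?_, ?_, ?_, ?_⟩
  · intro ha hb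
    have h1 := hrange 0 (by rw [hb, map_zero])
    simp only [zero_mul, neg_zero, hF0 ha, if_true, Finset.sum_const, nsmul_eq_mul] at h1
    apply mul_left_cancel₀ (pow_ne_zero 2 hpQ)
    linear_combination p * h1 + (cyc p i).card * ((p : ℚ) ^ e' * p ^ 3) * hMQ +
      ((p : ℚ) ^ e' * p ^ 3 + p ^ (m + s)) * ((p : ℚ) ^ e' * p ^ 3) / 2 * hCQ
  · rintro ha hb0 ⟨β, hb⟩
    have hβ : β ≠ 0 := by rintro rfl; rw [map_zero] at hb; exact hb0 hb.symm
    have h1 := hrange β hb.symm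
    rw [Finset.sum_eq_zero, mul_zero] at h1
    · have := (mul_eq_zero.1 h1).resolve_left hpQ
      exact_mod_cast this
    · intro c hc
      have hc0 : c ≠ 0 := (cyc_or i hi c).2 (Or.inl hc)
      rw [hF0 ha, if_neg (neg_ne_zero.2 (mul_ne_zero hβ hc0))]
      simp
  · intro _ _ hb
    exact hother hb
  · intro ha hb
    have hb' : b = algebraMap (ZMod p) _ 0 := by rw [hb, map_zero]
    refine ⟨hnons 0 hb', fun γ hγ => ⟨fun hg => ?_, fun hg => ?_⟩⟩
    · have h1 := hsolv ha 0 hb' γ hγ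
      simp only [zero_mul, neg_zero, rts_zero hp (QF p l γ) hg, Finset.sum_const, nsmul_eq_mul,
        Nat.cast_zero] at h1
      apply mul_left_cancel₀ (pow_ne_zero 3 hpQ)
      linear_combination h1 + (p : ℚ) ^ e' * p ^ 3 * ((p : ℚ) ^ e' * p ^ 3 + p * p ^ (m + s)) / 2 * hCQ
    · have h1 := hsolv ha 0 hb' γ hγ
      simp only [zero_mul, neg_zero, rts_two hp (QF p l γ) hg, Finset.sum_const, nsmul_eq_mul,
        Nat.cast_ofNat] at h1
      apply mul_left_cancel₀ (pow_ne_zero 3 hpQ)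
      linear_combination h1 + (p : ℚ) ^ e' * p ^ 3 * ((p : ℚ) ^ e' * p ^ 3 - p * p ^ (m + s)) / 2 * hCQ
  · rintro ha hb0 ⟨β, hb⟩
    have hβ : β ≠ 0 := by rintro rfl; rw [map_zero] at hb; exact hb0 hb.symm
    refine ⟨hnons β hb.symm, fun γ hγ => ?_⟩
    have h1 := hsolv ha β hb.symm γ hγ
    have h2 := rts_sum hp i hi (QF p l γ) β hβ
    have h3 : 2 * ∑ c ∈ cyc p i, (rts p (QF p l γ) (-(β * c)) : ℚ) =
      p - 1 - rts p (QF p l γ) 0 := by exact_mod_cast h2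
    refine ⟨fun hg => ?_, fun hg => ?_⟩
    · rw [rts_zero hp (QF p l γ) hg, Nat.cast_zero] at h3
      apply mul_left_cancel₀ (pow_ne_zero 3 hpQ)
      linear_combination h1 + (p : ℚ) ^ e' * p ^ 3 * ((p : ℚ) ^ e' * p ^ 3 + p * p ^ (m + s)) / 2 * hCQ
        - (p : ℚ) ^ e' * p ^ 3 * (p * p ^ (m + s)) / 2 * h3
    · rw [rts_two hp (QF p l γ) hg, Nat.cast_ofNat] at h3
      apply mul_left_cancel₀ (pow_ne_zero 3 hpQ)
      linear_combination h1 + (p : ℚ) ^ e' * p ^ 3 * ((p : ℚ) ^ e' * p ^ 3 + p * p ^ (m + s)) / 2 * hCQ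
        - (p : ℚ) ^ e' * p ^ 3 * (p * p ^ (m + s)) / 2 * h3
  · intro _ _ hb
    exact hother hb


end
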